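/- arXiv:2011.12624 — 2 statements merged into one kernel-verified Lean document; each statement's English description precedes it below -/
import Mathlib

section
/- For every (z,t) ∈ ℝ^m × ℝ^k with z ≠ 0, the second derivatives of the gauge ρ along the vector fields are: (1) for 1 ≤ i, j ≤ m, X_iX_jρ = −(2γ+1) z_i z_j ψ²/ρ³ + (2γ z_i z_j/|z|² + δ_{ij}) ψ/ρ; (2) for 1 ≤ i ≤ m and 1 ≤ j ≤ k, X_iX_{m+j}ρ = −(2γ+1)(γ+1) z_i t_j |z|^{−γ} ψ²/ρ³ + γ(γ+1) z_i t_j |z|^{−(γ+2)} ψ/ρ; (3) for 1 ≤ i ≤ m and 1 ≤ j ≤ k, X_{m+j}X_iρ = −(2γ+1)(γ+1) z_i t_j |z|^{−γ} ψ²/ρ³; (4) for 1 ≤ i, j ≤ k, X_{m+i}X_{m+j}ρ = −(2γ+1)(γ+1)² t_i t_j |z|^{−2γ} ψ²/ρ³ + (γ+1) δ_{ij} ψ/ρ. -/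
open MeasureTheory Real Set Filter Asymptotics

noncomputable section

/-- The underlying space ℝ^m × ℝ^k. -/
abbrev E (m k : ℕ) : Type :=
  EuclideanSpace ℝ (Fin m) × EuclideanSpace ℝ (Fin k)

namespace BG

variable {m k : ℕ}

/-- The Baouendi–Grushin gauge ρ. -/
def rho (γ : ℝ) (p : E m k) : ℝ :=
  (‖p.1‖ ^ (2 * (γ + 1)) + (γ + 1) ^ 2 * ‖p.2‖ ^ 2) ^ (1 / (2 * (γ + 1)))

/-- The angle function ψ = |z|^{2γ}/ρ^{2γ}. -/
def psi (γ : ℝ) (p : E m k) : ℝ :=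
  ‖p.1‖ ^ (2 * γ) / rho γ p ^ (2 * γ)

/-- The gauge ball B_r = {ρ < r}. -/
def ball (γ r : ℝ) : Set (E m k) := {p | rho γ p < r}

/-- The Baouendi–Grushin vector fields as direction fields:
X_i = ∂_{z_i} for i < m, X_{m+j} = |z|^γ ∂_{t_j}. -/
def Xvec (γ : ℝ) (p : E m k) (i : Fin (m + k)) : E m k :=
  if h : (i : ℕ) < m then (EuclideanSpace.single ⟨(i : ℕ), h⟩ 1, 0)
  else (0, EuclideanSpace.single ⟨(i : ℕ) - m, by have := i.isLt; omega⟩ (‖p.1‖ ^ γ))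

/-- Derivative along the i-th Baouendi–Grushin vector field. -/
def Xd (γ : ℝ) (i : Fin (m + k)) (f : E m k → ℝ) (p : E m k) : ℝ :=
  fderiv ℝ f p (Xvec γ p i)

/-- The quadratic form ⟨A Xu, Xu⟩. -/
def quadA (γ : ℝ) (A : E m k → Matrix (Fin (m + k)) (Fin (m + k)) ℝ)
    (u : E m k → ℝ) (p : E m k) : ℝ :=
  ∑ i, ∑ j, A p i j * Xd γ i u p * Xd γ j u p

/-- μ = ⟨A Xρ, Xρ⟩. -/
def mu (γ : ℝ) (A : E m k → Matrix (Fin (m + k)) (Fin (m + k)) ℝ) (p : E m k) : ℝ :=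
  quadA γ A (rho γ) p

/-- The operator 𝓛 u = Σ_{i,j} X_i(a_{ij} X_j u). -/
def Lop (γ : ℝ) (A : E m k → Matrix (Fin (m + k)) (Fin (m + k)) ℝ)
    (u : E m k → ℝ) (p : E m k) : ℝ :=
  ∑ i, ∑ j, Xd γ i (fun q => A q i j * Xd γ j u q) p

/-- The vector field F = (ρ/μ) Σ a_{ij} X_iρ X_j, as a first order operator. -/
def Fop (γ : ℝ) (A : E m k → Matrix (Fin (m + k)) (Fin (m + k)) ℝ)
    (v : E m k → ℝ) (p : E m k) : ℝ :=
  rho γ p / mu γ A p * ∑ i, ∑ j, A p i j * Xd γ i (rho γ) p * Xd γ j v p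

/-- The Baouendi–Grushin operator 𝓑_γ = Δ_z + |z|^{2γ} Δ_t = Σ_i X_i X_i. -/
def Bop (γ : ℝ) (u : E m k → ℝ) (p : E m k) : ℝ :=
  ∑ i : Fin (m + k), Xd γ i (Xd γ i u) p

/-- The generator of anisotropic dilations Z = Σ z_i ∂_{z_i} + (γ+1) Σ t_j ∂_{t_j},
as a first order operator: the derivative in the direction (z, (γ+1) t). -/
def Zd (γ : ℝ) (v : E m k → ℝ) (p : E m k) : ℝ :=
  fderiv ℝ v p (p.1, (γ + 1) • p.2)

/-- The Euclidean divergence of a vector field on ℝ^m × ℝ^k. -/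
def divV (V : E m k → E m k) (p : E m k) : ℝ :=
  (∑ i : Fin m, (fderiv ℝ V p (EuclideanSpace.single i 1, 0)).1 i) +
    ∑ j : Fin k,
      (fderiv ℝ V p ((0 : EuclideanSpace ℝ (Fin m)), EuclideanSpace.single j 1)).2 j

/-- Uniform ellipticity: λ|η|² ≤ ⟨Aη,η⟩ ≤ λ⁻¹|η|². -/
def Elliptic (lam : ℝ) (A : E m k → Matrix (Fin (m + k)) (Fin (m + k)) ℝ) : Prop :=
  ∀ (p : E m k) (η : Fin (m + k) → ℝ),
    lam * ∑ i, η i ^ 2 ≤ ∑ i, ∑ j, A p i j * η i * η j ∧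
      ∑ i, ∑ j, A p i j * η i * η j ≤ lam⁻¹ * ∑ i, η i ^ 2

/-- Symmetry of the matrix A. -/
def Symm (A : E m k → Matrix (Fin (m + k)) (Fin (m + k)) ℝ) : Prop :=
  ∀ p i j, A p i j = A p j i

/-- The entries of A are C¹. -/
def C1coeff (A : E m k → Matrix (Fin (m + k)) (Fin (m + k)) ℝ) : Prop :=
  ∀ i j, ContDiff ℝ 1 fun p => A p i j

/-- The structural hypothesis (H) on B = A - I, in B_1. -/
def HypH (γ Λ : ℝ) (A : E m k → Matrix (Fin (m + k)) (Fin (m + k)) ℝ) : Prop :=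
  ∀ p ∈ ball (m := m) (k := k) γ 1,
    (∀ i j : Fin (m + k),
        |(A p - 1) i j| ≤
          if (i : ℕ) < m ∧ (j : ℕ) < m then Λ * rho γ p
          else Λ * psi γ p ^ ((1 : ℝ) / 2 + 1 / (2 * γ)) * rho γ p) ∧
      ∀ l i j : Fin (m + k),
        |Xd γ l (fun q => (A q - 1) i j) p| ≤
          if (l : ℕ) < m ∧ (i : ℕ) < m ∧ (j : ℕ) < m then Λ
          else if m ≤ (l : ℕ) ∧ (m ≤ (i : ℕ) ∨ m ≤ (j : ℕ)) then
            Λ * psi γ p ^ ((1 : ℝ) + 1 / (2 * γ))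
          else Λ * psi γ p ^ ((1 : ℝ) / 2)

end BG

namespace BG

variable {m k : ℕ}

lemma Xvec_castAdd (γ : ℝ) (p : E m k) (i : Fin m) :
    Xvec γ p (Fin.castAdd k i) = (EuclideanSpace.single i 1, 0) := by
  simp [Xvec]

lemma Xvec_natAdd (γ : ℝ) (p : E m k) (j : Fin k) :
    Xvec γ p (Fin.natAdd m j) = (0, EuclideanSpace.single j (‖p.1‖ ^ γ)) := by
  simp [Xvec]

lemma norm_rpow_deriv (s : ℝ) (p : E m k) (hz : p.1 ≠ 0) :
    HasFDerivAt (fun q : E m k => ‖q.1‖ ^ s)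
      ((s * ‖p.1‖ ^ (s - 2)) •
        (innerSL ℝ p.1).comp (ContinuousLinearMap.fst ℝ _ (EuclideanSpace ℝ (Fin k)))) p := by
  have h0 : 0 < ‖p.1‖ := norm_pos_iff.mpr hz
  have h1 : HasFDerivAt (fun q : E m k => ‖q.1‖ ^ 2) _ p :=
    (hasFDerivAt_fst (𝕜 := ℝ) (p := p)).norm_sq
  have h2 := h1.rpow_const (p := s / 2) (Or.inl (by positivity))
  have e : (fun q : E m k => (‖q.1‖ ^ 2) ^ (s / 2)) = fun q : E m k => ‖q.1‖ ^ s := by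
    funext q
    rw [← Real.rpow_natCast, ← Real.rpow_mul (norm_nonneg _)]
    congr 1
    push_cast
    ring
  rw [e] at h2
  refine h2.congr_fderiv ?_
  ext v <;> simp
  all_goals
    rw [← Real.rpow_natCast, ← Real.rpow_mul (norm_nonneg _)]
    have : ((2 : ℕ) : ℝ) * (s / 2 - 1) = s - 2 := by push_cast; ring
    rw [this]
    ring

/-- the first differential of the gauge, up to the factor ρ^{-(2γ+1)} -/
def dG (γ : ℝ) (p : E m k) : E m k →L[ℝ] ℝ :=
  (‖p.1‖ ^ (2 * γ)) •
      (innerSL ℝ p.1).comp (ContinuousLinearMap.fst ℝ _ (EuclideanSpace ℝ (Fin k)))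
    + (γ + 1) •
      (innerSL ℝ p.2).comp (ContinuousLinearMap.snd ℝ (EuclideanSpace ℝ (Fin m)) _)

lemma rho_pos (γ : ℝ) (p : E m k) (hz : p.1 ≠ 0) : 0 < rho γ p := by
  have h0 : 0 < ‖p.1‖ := norm_pos_iff.mpr hz
  unfold rho
  positivity

lemma rho_deriv (γ : ℝ) (hγ : 0 < γ) (p : E m k) (hz : p.1 ≠ 0) :
    HasFDerivAt (rho γ : E m k → ℝ) ((rho γ p ^ (-(2 * γ + 1))) • dG γ p) p := by
  have h0 : 0 < ‖p.1‖ := norm_pos_iff.mpr hz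
  have h1 := norm_rpow_deriv (2 * (γ + 1)) p hz
  have h2 : HasFDerivAt (fun q : E m k => ‖q.2‖ ^ 2) _ p :=
    (hasFDerivAt_snd (𝕜 := ℝ) (p := p)).norm_sq
  have hN : 0 < ‖p.1‖ ^ (2 * (γ + 1)) + (γ + 1) ^ 2 * ‖p.2‖ ^ 2 := by positivity
  have h3 := (h1.add (h2.const_mul ((γ + 1) ^ 2))).rpow_const
    (p := 1 / (2 * (γ + 1))) (Or.inl hN.ne')
  refine HasFDerivAt.congr_fderiv (f := rho γ) h3 ?_
  have hr : rho γ p ^ (-(2 * γ + 1)) =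
      (‖p.1‖ ^ (2 * (γ + 1)) + (γ + 1) ^ 2 * ‖p.2‖ ^ 2) ^ (1 / (2 * (γ + 1)) - 1) := by
    unfold rho
    rw [← Real.rpow_mul hN.le]
    congr 1
    field_simp
    ring
  have e2 : 2 * (γ + 1) - 2 = 2 * γ := by ring
  rw [hr, e2]
  have hg : γ + 1 ≠ 0 := by positivity
  ext v
  · simp [dG]
    field_simp
  · simp [dG]
    field_simp

/-- derivative of ρ^a |z|^b ℓ -/
lemma prod_deriv (γ : ℝ) (hγ : 0 < γ) (p : E m k) (hz : p.1 ≠ 0) (a b : ℝ)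
    (l : E m k →L[ℝ] ℝ) (v : E m k) (f : E m k → ℝ)
    (hf : ∀ q : E m k, q.1 ≠ 0 → f q = rho γ q ^ a * ‖q.1‖ ^ b * l q) :
    fderiv ℝ f p v =
      a * rho γ p ^ (a - 1) * rho γ p ^ (-(2 * γ + 1)) *
        (‖p.1‖ ^ (2 * γ) * inner ℝ p.1 v.1 + (γ + 1) * inner ℝ p.2 v.2) * ‖p.1‖ ^ b * l p
      + rho γ p ^ a * (b * ‖p.1‖ ^ (b - 2) * inner ℝ p.1 v.1) * l p
      + rho γ p ^ a * ‖p.1‖ ^ b * l v := by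
  have hev : f =ᶠ[nhds p] fun q => rho γ q ^ a * ‖q.1‖ ^ b * l q := by
    have ho : IsOpen {q : E m k | q.1 ≠ 0} := isOpen_ne_fun continuous_fst continuous_const
    filter_upwards [ho.mem_nhds hz] with q hq using hf q hq
  have h1 := (rho_deriv γ hγ p hz).rpow_const (p := a) (Or.inl (rho_pos γ p hz).ne')
  have h2 := (h1.mul (norm_rpow_deriv b p hz)).mul l.hasFDerivAt
  rw [hev.fderiv_eq]
  have h3 : HasFDerivAt (fun q : E m k => rho γ q ^ a * ‖q.1‖ ^ b * l q) _ p := h2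
  rw [h3.fderiv]
  simp [dG]
  ring

lemma Xd_rho_cast (γ : ℝ) (hγ : 0 < γ) (j : Fin m) (q : E m k) (hq : q.1 ≠ 0) :
    Xd γ (Fin.castAdd k j) (rho γ) q = rho γ q ^ (-(2 * γ + 1)) * ‖q.1‖ ^ (2 * γ) *
      ((EuclideanSpace.proj j).comp (ContinuousLinearMap.fst ℝ _ _) : E m k →L[ℝ] ℝ) q := by
  rw [Xd, (rho_deriv γ hγ q hq).fderiv, Xvec_castAdd]
  simp [dG, EuclideanSpace.inner_single_right]
  ring

lemma Xd_rho_nat (γ : ℝ) (hγ : 0 < γ) (j : Fin k) (q : E m k) (hq : q.1 ≠ 0) :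
    Xd γ (Fin.natAdd m j) (rho γ) q = rho γ q ^ (-(2 * γ + 1)) * ‖q.1‖ ^ γ *
      ((γ + 1) • (EuclideanSpace.proj j).comp (ContinuousLinearMap.snd ℝ _ _)
        : E m k →L[ℝ] ℝ) q := by
  rw [Xd, (rho_deriv γ hγ q hq).fderiv, Xvec_natAdd]
  simp [dG, EuclideanSpace.inner_single_right]
  ring

end BG

open BG in
/-- second derivatives of the gauge ρ along the vector fields
(Lemma `secondder` of the paper). -/
theorem gauge_second_derivatives
    (m k : ℕ) (hm : 1 ≤ m) (hk : 1 ≤ k) (γ : ℝ) (hγ : 0 < γ)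
    (p : E m k) (hz : p.1 ≠ 0) :
    (∀ i j : Fin m,
        Xd γ (Fin.castAdd k i) (Xd γ (Fin.castAdd k j) (rho γ)) p
          = -(2 * γ + 1) * p.1 i * p.1 j * psi γ p ^ 2 / rho γ p ^ 3
            + (2 * γ * p.1 i * p.1 j / ‖p.1‖ ^ 2
                + (if i = j then (1 : ℝ) else 0)) * psi γ p / rho γ p) ∧
      (∀ (i : Fin m) (j : Fin k),
        Xd γ (Fin.castAdd k i) (Xd γ (Fin.natAdd m j) (rho γ)) p
          = -((2 * γ + 1) * (γ + 1)) * p.1 i * p.2 j / ‖p.1‖ ^ γ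
              * psi γ p ^ 2 / rho γ p ^ 3
            + γ * (γ + 1) * p.1 i * p.2 j / ‖p.1‖ ^ (γ + 2)
              * psi γ p / rho γ p) ∧
      (∀ (i : Fin m) (j : Fin k),
        Xd γ (Fin.natAdd m j) (Xd γ (Fin.castAdd k i) (rho γ)) p
          = -((2 * γ + 1) * (γ + 1)) * p.1 i * p.2 j / ‖p.1‖ ^ γ
              * psi γ p ^ 2 / rho γ p ^ 3) ∧
      ∀ i j : Fin k,
        Xd γ (Fin.natAdd m i) (Xd γ (Fin.natAdd m j) (rho γ)) p
          = -((2 * γ + 1) * (γ + 1) ^ 2) * p.2 i * p.2 j / ‖p.1‖ ^ (2 * γ)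
              * psi γ p ^ 2 / rho γ p ^ 3
            + (γ + 1) * (if i = j then (1 : ℝ) else 0) * psi γ p / rho γ p := by
  have h0 : 0 < ‖p.1‖ := norm_pos_iff.mpr hz
  have hr : 0 < rho γ p := rho_pos γ p hz
  have a1 : rho γ p ^ (-(2 * γ + 1)) = 1 / ((rho γ p ^ γ) ^ 2 * rho γ p) := by
    rw [Real.rpow_neg hr.le, Real.rpow_add hr, Real.rpow_one, two_mul, Real.rpow_add hr]
    ring
  have a2 : rho γ p ^ (-(2 * γ + 1) - 1) = 1 / ((rho γ p ^ γ) ^ 2 * rho γ p ^ 2) := by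
    rw [Real.rpow_sub hr, a1, Real.rpow_one]
    field_simp
  have a3 : ‖p.1‖ ^ (2 * γ) = (‖p.1‖ ^ γ) ^ 2 := by
    rw [two_mul, Real.rpow_add h0]; ring
  have a4 : ‖p.1‖ ^ (2 * γ - 2) = (‖p.1‖ ^ γ) ^ 2 / ‖p.1‖ ^ 2 := by
    rw [Real.rpow_sub h0, a3, Real.rpow_two]
  have a5 : ‖p.1‖ ^ (γ - 2) = ‖p.1‖ ^ γ / ‖p.1‖ ^ 2 := by
    rw [Real.rpow_sub h0, Real.rpow_two]
  have a6 : ‖p.1‖ ^ (γ + 2) = ‖p.1‖ ^ γ * ‖p.1‖ ^ 2 := by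
    rw [Real.rpow_add h0, Real.rpow_two]
  have a7 : psi γ p = (‖p.1‖ ^ γ) ^ 2 / (rho γ p ^ γ) ^ 2 := by
    rw [psi, a3, two_mul, Real.rpow_add hr]; ring
  have hR : 0 < rho γ p ^ γ := Real.rpow_pos_of_pos hr _
  have hS : 0 < ‖p.1‖ ^ γ := Real.rpow_pos_of_pos h0 _
  refine ⟨fun i j => ?_, fun i j => ?_, fun i j => ?_, fun i j => ?_⟩
  · rw [Xd, prod_deriv γ hγ p hz _ _ _ _ _ (Xd_rho_cast γ hγ j), Xvec_castAdd, a1, a2, a4, a3, a7]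
    by_cases hij : i = j
    · subst hij
      simp [EuclideanSpace.inner_single_right, -one_div]
      field_simp
      ring
    · have hji : j ≠ i := fun h => hij h.symm
      simp [EuclideanSpace.inner_single_right, -one_div, hij, hji]
      field_simp
  · rw [Xd, prod_deriv γ hγ p hz _ _ _ _ _ (Xd_rho_nat γ hγ j), Xvec_castAdd, a1, a2, a5, a3, a7, a6]
    simp [EuclideanSpace.inner_single_right, -one_div]
    field_simp
    ring
  · rw [Xd, prod_deriv γ hγ p hz _ _ _ _ _ (Xd_rho_cast γ hγ i), Xvec_natAdd, a1, a2, a4, a3, a7]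
    simp [EuclideanSpace.inner_single_right, -one_div]
    field_simp
    try ring
  · rw [Xd, prod_deriv γ hγ p hz _ _ _ _ _ (Xd_rho_nat γ hγ j), Xvec_natAdd, a1, a2, a5, a3, a7]
    by_cases hij : i = j
    · subst hij
      simp [EuclideanSpace.inner_single_right, -one_div]
      field_simp
      ring
    · have hji : j ≠ i := fun h => hij h.symm
      simp [EuclideanSpace.inner_single_right, -one_div, hij, hji]
      field_simp
      try ring
end
end

section
/- At every point (z,t) ∈ ℝ^m × ℝ^k with z ≠ 0 one has 𝓑_γ( ρ^{2−Q} ) = 0; that is, the function (z,t) ↦ ρ(z,t)^{2−Q} is a solution of the Baouendi–Grushin equation away from the characteristic set {z = 0}. -/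
open MeasureTheory Real Set Filter Asymptotics

noncomputable section

namespace BG

lemma hasF_S {m k : ℕ} (q : E m k) : HasFDerivAt (fun q : E m k => ‖q.1‖ ^ 2)
    ((2 : ℝ) • (innerSL ℝ q.1).comp (ContinuousLinearMap.fst ℝ _ _)) q := by
  have h := (hasStrictFDerivAt_norm_sq q.1).hasFDerivAt.comp q
    (hasFDerivAt_fst (𝕜 := ℝ) (p := q))
  refine h.congr_fderiv ?_
  ext v <;> simp

lemma hasF_T {m k : ℕ} (q : E m k) : HasFDerivAt (fun q : E m k => ‖q.2‖ ^ 2)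
    ((2 : ℝ) • (innerSL ℝ q.2).comp (ContinuousLinearMap.snd ℝ _ _)) q := by
  have h := (hasStrictFDerivAt_norm_sq q.2).hasFDerivAt.comp q
    (hasFDerivAt_snd (𝕜 := ℝ) (p := q))
  refine h.congr_fderiv ?_
  ext v <;> simp

/-- The function G = |z|^{2(γ+1)} + (γ+1)²|t|². -/
def GG {m k : ℕ} (γ : ℝ) (q : E m k) : ℝ :=
  (‖q.1‖ ^ 2) ^ (γ + 1) + (γ + 1) ^ 2 * ‖q.2‖ ^ 2

lemma GG_pos {m k : ℕ} (γ : ℝ) (q : E m k) (hq : q.1 ≠ 0) : 0 < GG γ q := by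
  have : 0 < ‖q.1‖ := norm_pos_iff.2 hq
  unfold GG
  positivity

lemma hasF_Spow {m k : ℕ} (c : ℝ) (q : E m k) (hq : q.1 ≠ 0) :
    HasFDerivAt (fun q : E m k => (‖q.1‖ ^ 2) ^ c)
    ((c * (‖q.1‖ ^ 2) ^ (c - 1)) •
      ((2 : ℝ) • (innerSL ℝ q.1).comp (ContinuousLinearMap.fst ℝ _ _))) q := by
  have : 0 < ‖q.1‖ := norm_pos_iff.2 hq
  exact (hasF_S q).rpow_const (Or.inl (by positivity))

lemma hasF_GGpow {m k : ℕ} (γ b : ℝ) (q : E m k) (hq : q.1 ≠ 0) :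
    HasFDerivAt (fun q : E m k => GG γ q ^ b)
    ((b * GG γ q ^ (b - 1)) • ((((γ + 1) * (‖q.1‖ ^ 2) ^ (γ + 1 - 1)) •
      ((2 : ℝ) • (innerSL ℝ q.1).comp (ContinuousLinearMap.fst ℝ _ _))) +
      (γ + 1) ^ 2 • ((2 : ℝ) • (innerSL ℝ q.2).comp (ContinuousLinearMap.snd ℝ _ _)))) q :=
  HasFDerivAt.rpow_const ((hasF_Spow (γ + 1) q hq).add ((hasF_T q).const_mul ((γ + 1) ^ 2)))
    (Or.inl (GG_pos γ q hq).ne')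

lemma Xvec_l {m k : ℕ} (γ : ℝ) (q : E m k) (i : Fin m) :
    Xvec γ q (Fin.castAdd k i) = (EuclideanSpace.single i 1, 0) := by
  simp [Xvec]

lemma Xvec_r {m k : ℕ} (γ : ℝ) (q : E m k) (j : Fin k) :
    Xvec γ q (Fin.natAdd m j) = (0, EuclideanSpace.single j (‖q.1‖ ^ γ)) := by
  simp [Xvec]

lemma ev_ne {m k : ℕ} (p : E m k) (hp : p.1 ≠ 0) : ∀ᶠ q in nhds p, q.1 ≠ 0 :=
  continuous_fst.continuousAt.eventually_ne hp

lemma rho_eq {m k : ℕ} (γ c : ℝ) (hγ : 0 < γ) (q : E m k) :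
    rho γ q ^ c = GG γ q ^ (c / (2 * (γ + 1))) := by
  have h : ‖q.1‖ ^ (2 * (γ + 1)) = (‖q.1‖ ^ 2) ^ (γ + 1) := by
    rw [Real.rpow_mul (norm_nonneg _), Real.rpow_two]
  unfold rho GG
  rw [h, ← Real.rpow_mul (by positivity)]
  congr 1
  ring

lemma Xd_l {m k : ℕ} (γ b : ℝ) (q : E m k) (hq : q.1 ≠ 0) (i : Fin m) :
    Xd γ (Fin.castAdd k i) (fun q => GG γ q ^ b) q =
      2 * (γ + 1) * b * (GG γ q ^ (b - 1) * ((‖q.1‖ ^ 2) ^ γ * q.1 i)) := by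
  unfold Xd
  rw [(hasF_GGpow γ b q hq).fderiv, Xvec_l]
  simp [EuclideanSpace.inner_single_right]
  ring

lemma Xd_r {m k : ℕ} (γ b : ℝ) (q : E m k) (hq : q.1 ≠ 0) (j : Fin k) :
    Xd γ (Fin.natAdd m j) (fun q => GG γ q ^ b) q =
      2 * (γ + 1) ^ 2 * b * (GG γ q ^ (b - 1) * ((‖q.1‖ ^ 2) ^ (γ / 2) * q.2 j)) := by
  have h : (‖q.1‖ ^ 2) ^ (γ / 2) = ‖q.1‖ ^ γ := by
    rw [← Real.rpow_two, ← Real.rpow_mul (norm_nonneg _)]; congr 1; ring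
  unfold Xd
  rw [(hasF_GGpow γ b q hq).fderiv, Xvec_r, h]
  simp [EuclideanSpace.inner_single_right]
  ring

lemma XXd_l {m k : ℕ} (γ b : ℝ) (p : E m k) (hp : p.1 ≠ 0) (i : Fin m) :
    Xd γ (Fin.castAdd k i) (Xd γ (Fin.castAdd k i) (fun q => GG γ q ^ b)) p =
      2 * (γ + 1) * b * (2 * (γ + 1) * (b - 1) * GG γ p ^ (b - 1 - 1) *
          ((‖p.1‖ ^ 2) ^ γ * (‖p.1‖ ^ 2) ^ γ) * (p.1 i) ^ 2 +
        GG γ p ^ (b - 1) * (2 * γ * (‖p.1‖ ^ 2) ^ (γ - 1) * (p.1 i) ^ 2 + (‖p.1‖ ^ 2) ^ γ)) := by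
  have he : Xd γ (Fin.castAdd k i) (fun q : E m k => GG γ q ^ b) =ᶠ[nhds p]
      fun q => 2 * (γ + 1) * b * (GG γ q ^ (b - 1) * ((‖q.1‖ ^ 2) ^ γ * q.1 i)) :=
    (ev_ne p hp).mono fun q hq => Xd_l γ b q hq i
  have hc : HasFDerivAt (fun q : E m k => q.1 i)
      ((EuclideanSpace.proj (𝕜 := ℝ) i).comp (ContinuousLinearMap.fst ℝ _ _)) p :=
    ((EuclideanSpace.proj (𝕜 := ℝ) i).comp (ContinuousLinearMap.fst ℝ _
      (EuclideanSpace ℝ (Fin k)))).hasFDerivAt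
  have hd := ((hasF_GGpow γ (b - 1) p hp).mul ((hasF_Spow γ p hp).mul hc)).const_mul
    (2 * (γ + 1) * b)
  unfold Xd at he ⊢
  rw [he.fderiv_eq, Xvec_l]
  erw [hd.fderiv]
  simp [EuclideanSpace.inner_single_right]
  ring

lemma XXd_r {m k : ℕ} (γ b : ℝ) (p : E m k) (hp : p.1 ≠ 0) (j : Fin k) :
    Xd γ (Fin.natAdd m j) (Xd γ (Fin.natAdd m j) (fun q => GG γ q ^ b)) p =
      2 * (γ + 1) ^ 2 * b * (‖p.1‖ ^ 2) ^ γ *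
        (2 * (γ + 1) ^ 2 * (b - 1) * GG γ p ^ (b - 1 - 1) * (p.2 j) ^ 2 +
        GG γ p ^ (b - 1)) := by
  have he : Xd γ (Fin.natAdd m j) (fun q : E m k => GG γ q ^ b) =ᶠ[nhds p]
      fun q => 2 * (γ + 1) ^ 2 * b *
        (GG γ q ^ (b - 1) * ((‖q.1‖ ^ 2) ^ (γ / 2) * q.2 j)) :=
    (ev_ne p hp).mono fun q hq => Xd_r γ b q hq j
  have hc : HasFDerivAt (fun q : E m k => q.2 j)
      ((EuclideanSpace.proj (𝕜 := ℝ) j).comp (ContinuousLinearMap.snd ℝ _ _)) p :=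
    ((EuclideanSpace.proj (𝕜 := ℝ) j).comp (ContinuousLinearMap.snd ℝ
      (EuclideanSpace ℝ (Fin m)) _)).hasFDerivAt
  have hd := ((hasF_GGpow γ (b - 1) p hp).mul ((hasF_Spow (γ / 2) p hp).mul hc)).const_mul
    (2 * (γ + 1) ^ 2 * b)
  have h : (‖p.1‖ ^ 2) ^ (γ / 2) = ‖p.1‖ ^ γ := by
    rw [← Real.rpow_two, ← Real.rpow_mul (norm_nonneg _)]; congr 1; ring
  have h2 : (‖p.1‖ ^ 2) ^ γ = ‖p.1‖ ^ γ * ‖p.1‖ ^ γ := by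
    rw [← h, ← Real.rpow_add (by have := norm_pos_iff.2 hp; positivity)]; congr 1; ring
  unfold Xd at he ⊢
  rw [he.fderiv_eq, Xvec_r]
  erw [hd.fderiv]
  simp [EuclideanSpace.inner_single_right, h, h2]
  ring

end BG

open BG in
/-- ρ^{2-Q} solves the Baouendi–Grushin equation away from {z = 0}. -/
theorem fundamental_solution_grushin
    (m k : ℕ) (hm : 1 ≤ m) (hk : 1 ≤ k) (γ : ℝ) (hγ : 0 < γ)
    (p : E m k) (hz : p.1 ≠ 0) :
    Bop γ (fun q => rho γ q ^ (2 - ((m : ℝ) + (γ + 1) * k))) p = 0 := by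
  have hs : 0 < ‖p.1‖ ^ 2 := by have := norm_pos_iff.2 hz; positivity
  have hG := GG_pos γ p hz
  simp only [rho_eq γ _ hγ]
  obtain ⟨b, hb⟩ : ∃ b, b = (2 - ((m : ℝ) + (γ + 1) * k)) / (2 * (γ + 1)) := ⟨_, rfl⟩
  rw [← hb]
  have hb' : 2 * (γ + 1) * b = 2 - ((m : ℝ) + (γ + 1) * k) := by
    rw [hb]; field_simp
  have e1 : ∑ i, (p.1 i) ^ 2 = ‖p.1‖ ^ 2 := (EuclideanSpace.real_norm_sq_eq p.1).symm
  have e2 : ∑ i, (p.2 i) ^ 2 = ‖p.2‖ ^ 2 := (EuclideanSpace.real_norm_sq_eq p.2).symm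
  have e3 : (‖p.1‖ ^ 2) ^ (γ - 1) * ‖p.1‖ ^ 2 = (‖p.1‖ ^ 2) ^ γ := by
    rw [Real.rpow_sub_one hs.ne']; field_simp
  have e4 : GG γ p ^ (b - 1) = GG γ p ^ (b - 1 - 1) * GG γ p := by
    rw [Real.rpow_sub_one hG.ne' (b - 1)]; field_simp
  have e5 : GG γ p = (‖p.1‖ ^ 2) ^ γ * ‖p.1‖ ^ 2 + (γ + 1) ^ 2 * ‖p.2‖ ^ 2 := by
    rw [← Real.rpow_add_one hs.ne']; rfl
  unfold Bop
  rw [Fin.sum_univ_add]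
  simp only [XXd_l γ b p hz, XXd_r γ b p hz]
  simp only [← Finset.mul_sum, Finset.sum_add_distrib, e1, e2, Finset.sum_const,
    Finset.card_univ, Fintype.card_fin, nsmul_eq_mul]
  rw [mul_assoc (2 * γ), e3, e4]
  generalize GG γ p ^ (b - 1 - 1) = H at *
  generalize (‖p.1‖ ^ 2) ^ γ = W at *
  generalize ‖p.1‖ ^ 2 = S at *
  generalize ‖p.2‖ ^ 2 = T at *
  generalize GG γ p = G at *
  have hm' : (m : ℝ) = 2 - 2 * (γ + 1) * b - (γ + 1) * k := by linarith
  rw [hm', e5]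
  ring
end
end
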